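/- arXiv:1008.2814 — 2 statements merged into one kernel-verified Lean document; each statement's English description precedes it below -/
import Mathlib

section
/- (Sufficient condition for optimality and uniqueness, Theorem 2.3.) Suppose some admissible matrix S̃ satisfies ‖S̃‖ ≤ r̂ − 1, where ‖·‖ is the spectral norm. Then X* is an optimal solution of the SDP relaxation, and the k-disjoint-clique subgraph formed by C_1,…,C_k has the maximum number of nodes among all k-disjoint-clique subgraphs of G. If moreover ‖S̃‖ < r̂ − 1 and n_v^q < r_q for every vertex v ∈ V and every q ∈ {1,…,k} with v ∉ C_q, then X* is the unique optimal solution of the SDP relaxation and this subgraph is the unique maximum node k-disjoint-clique subgraph of G. -/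
open Finset Matrix
open scoped Classical

/-- Feasibility for the SDP relaxation of the maximum node `k`-disjoint-clique problem. -/
def SDPFeasible {N : ℕ} (G : SimpleGraph (Fin N)) (k : ℕ)
    (X : Matrix (Fin N) (Fin N) ℝ) : Prop :=
  X.IsSymm ∧
  (∀ i, ∑ j, X i j ≤ 1) ∧
  (∀ i j, i ≠ j → ¬ G.Adj i j → X i j = 0) ∧
  X.trace = (k : ℝ) ∧
  X.PosSemidef

/-- Number of neighbors of `v` (w.r.t. `G`) inside the vertex set `S`. -/
noncomputable def nnb {N : ℕ} (G : SimpleGraph (Fin N)) (v : Fin N)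
    (S : Finset (Fin N)) : ℕ :=
  (S.filter fun u => G.Adj v u).card

/-- The spectral norm of a real matrix: the supremum of the Euclidean norms `‖M x‖₂`
over vectors `x` with `‖x‖₂ ≤ 1`. -/
noncomputable def specNorm {m n : Type*} [Fintype m] [Fintype n]
    (M : Matrix m n ℝ) : ℝ :=
  sSup {t : ℝ | ∃ x : n → ℝ, ∑ j, (x j) ^ 2 ≤ 1 ∧
    t = Real.sqrt (∑ i, (∑ j, M i j * x j) ^ 2)}

/-- The constant `c_{q,s} = (r̂/2)(1/r_q + 1/r_s)` for `q, s ≤ k`. -/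
noncomputable def cqs {N k : ℕ} (C : Fin k → Finset (Fin N)) (rhat : ℕ)
    (q s : Fin k) : ℝ :=
  (rhat : ℝ) / 2 * (1 / ((C q).card : ℝ) + 1 / ((C s).card : ℝ))

/-- The constant `c_{q,k+1} = (r̂/2)(1/r̂ + 1/r_q)`. -/
noncomputable def cqK {N k : ℕ} (C : Fin k → Finset (Fin N)) (rhat : ℕ)
    (q : Fin k) : ℝ :=
  (rhat : ℝ) / 2 * (1 / (rhat : ℝ) + 1 / ((C q).card : ℝ))

/-- An admissible matrix `S̃` for the planted cliques `C 0, …, C (k-1)`: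
(i) diagonal blocks on cliques vanish; (ii) on a block `C_q × C_s` (`q ≠ s ≤ k`),
entries at edges equal `-c_{q,s}` and all row and column sums of the block vanish;
(iii) entries between `i ∈ C_q` and an outside node `j` equal `-c_{q,k+1}` at edges and
`c_{q,k+1}·n_j^q/(r_q - n_j^q)` at non-edges; (iv) entries between outside nodes equal
`-1` at edges and on the diagonal (and are arbitrary at non-adjacent outside pairs). -/
def Admissible {N k : ℕ} (G : SimpleGraph (Fin N))
    (C : Fin k → Finset (Fin N)) (rhat : ℕ)
    (St : Matrix (Fin N) (Fin N) ℝ) : Prop :=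
  St.IsSymm ∧
  (∀ q : Fin k, ∀ i ∈ C q, ∀ j ∈ C q, St i j = 0) ∧
  (∀ q s : Fin k, q ≠ s → ∀ i ∈ C q, ∀ j ∈ C s, G.Adj i j →
    St i j = -(cqs C rhat q s)) ∧
  (∀ q s : Fin k, q ≠ s → ∀ i ∈ C q, ∑ j ∈ C s, St i j = 0) ∧
  (∀ q s : Fin k, q ≠ s → ∀ j ∈ C s, ∑ i ∈ C q, St i j = 0) ∧
  (∀ q : Fin k, ∀ i ∈ C q, ∀ j : Fin N, (∀ s, j ∉ C s) →
    (G.Adj i j → St i j = -(cqK C rhat q) ∧ St j i = -(cqK C rhat q)) ∧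
    (¬ G.Adj i j →
      St i j = cqK C rhat q * (nnb G j (C q) : ℝ) /
        (((C q).card : ℝ) - (nnb G j (C q) : ℝ)) ∧
      St j i = St i j)) ∧
  (∀ i j : Fin N, (∀ s, i ∉ C s) → (∀ s, j ∉ C s) → (G.Adj i j ∨ i = j) →
    St i j = -1)

/-- The matrix with entries `1 / |C q|` on the block `C q × C q` and zero elsewhere. -/
noncomputable def cliqueMatrix {N k : ℕ} (C : Fin k → Finset (Fin N)) :
    Matrix (Fin N) (Fin N) ℝ :=
  fun i j => ∑ q, if i ∈ C q ∧ j ∈ C q then 1 / ((C q).card : ℝ) else 0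

open scoped MatrixOrder Matrix.Norms.L2Operator in
lemma exists_eq_transpose_mul_self {n : Type*} [Fintype n] {X : Matrix n n ℝ}
    (hX : X.PosSemidef) : ∃ B : Matrix n n ℝ, X = Bᵀ * B := by
  obtain ⟨B, hB⟩ := CStarAlgebra.nonneg_iff_eq_star_mul_self.mp hX.nonneg
  exact ⟨B, by rwa [Matrix.star_eq_conjTranspose,
    Matrix.conjTranspose_eq_transpose_of_trivial] at hB⟩

section SpecNorm

variable {m n : Type*} [Fintype m] [Fintype n]

lemma specNorm_bddAbove (M : Matrix m n ℝ) :
    BddAbove {t : ℝ | ∃ x : n → ℝ, ∑ j, (x j) ^ 2 ≤ 1 ∧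
      t = Real.sqrt (∑ i, (∑ j, M i j * x j) ^ 2)} := by
  refine ⟨Real.sqrt (∑ i, ∑ j, M i j ^ 2), ?_⟩
  rintro t ⟨x, hx, rfl⟩
  refine Real.sqrt_le_sqrt (Finset.sum_le_sum fun i _ => ?_)
  calc (∑ j, M i j * x j) ^ 2 ≤ (∑ j, M i j ^ 2) * ∑ j, x j ^ 2 :=
        Finset.sum_mul_sq_le_sq_mul_sq _ _ _
    _ ≤ (∑ j, M i j ^ 2) * 1 := by gcongr
    _ = _ := mul_one _

lemma specNorm_nonneg (M : Matrix m n ℝ) : 0 ≤ specNorm M :=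
  Real.sSup_nonneg (by rintro t ⟨x, -, rfl⟩; exact Real.sqrt_nonneg _)

lemma sum_mulVec_sq_le (M : Matrix m n ℝ) (x : n → ℝ) :
    ∑ i, (M *ᵥ x) i ^ 2 ≤ specNorm M ^ 2 * ∑ j, x j ^ 2 := by
  have h0 : 0 ≤ ∑ j, x j ^ 2 := Finset.sum_nonneg fun _ _ => sq_nonneg _
  rcases h0.eq_or_lt with h | h
  · have hx : x = 0 := by
      funext j
      have := (Finset.sum_eq_zero_iff_of_nonneg fun j _ => sq_nonneg (x j)).1 h.symm j
        (Finset.mem_univ j)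
      simpa using this
    simp [hx]
  · set a := Real.sqrt (∑ j, x j ^ 2) with ha
    have hapos : 0 < a := Real.sqrt_pos.2 h
    have ha2 : a ^ 2 = ∑ j, x j ^ 2 := Real.sq_sqrt h0
    have hle : Real.sqrt (∑ i, (∑ j, M i j * (x j / a)) ^ 2) ≤ specNorm M := by
      refine le_csSup (specNorm_bddAbove M) ⟨fun j => x j / a, ?_, rfl⟩
      simp only [div_pow, ← Finset.sum_div]
      rw [← ha2, div_self (by positivity)]
    rw [Real.sqrt_le_left (specNorm_nonneg M)] at hle
    have : ∑ i, (∑ j, M i j * (x j / a)) ^ 2 = (∑ i, (M *ᵥ x) i ^ 2) / a ^ 2 := by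
      simp only [Matrix.mulVec, dotProduct, ← mul_div_assoc, ← Finset.sum_div, div_pow]
    rw [this, div_le_iff₀ (by positivity), ha2] at hle
    exact hle

lemma neg_specNorm_mul_le_dotProduct (M : Matrix n n ℝ) (y : n → ℝ) :
    -(specNorm M * ∑ i, y i ^ 2) ≤ y ⬝ᵥ (M *ᵥ y) := by
  have h0 : 0 ≤ ∑ j, y j ^ 2 := Finset.sum_nonneg fun _ _ => sq_nonneg _
  have h1 : (y ⬝ᵥ (M *ᵥ y)) ^ 2 ≤ (specNorm M * ∑ i, y i ^ 2) ^ 2 := by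
    calc (y ⬝ᵥ (M *ᵥ y)) ^ 2 ≤ (∑ i, y i ^ 2) * ∑ i, (M *ᵥ y) i ^ 2 :=
          Finset.sum_mul_sq_le_sq_mul_sq _ _ _
      _ ≤ (∑ i, y i ^ 2) * (specNorm M ^ 2 * ∑ j, y j ^ 2) := by
          gcongr; exact sum_mulVec_sq_le M y
      _ = _ := by ring
  exact (abs_le.1 (abs_le_of_sq_le_sq h1 (mul_nonneg (specNorm_nonneg M) h0))).1

/-- If `P` is an orthogonal projection with `P * M = 0` and `‖M‖ ≤ r - 1`, then the quadratic
form of `M + r (1 - P)` dominates the squared distance to the range of `P`. -/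
lemma sum_sub_mulVec_sq_le (M P : Matrix n n ℝ) (r : ℝ) (hM : M.IsSymm) (hP : P.IsSymm)
    (hPP : P * P = P) (hPM : P * M = 0) (hr : specNorm M ≤ r - 1) (x : n → ℝ) :
    ∑ i, (x i - (P *ᵥ x) i) ^ 2 ≤ x ⬝ᵥ (M *ᵥ x) + r * (x ⬝ᵥ x - x ⬝ᵥ (P *ᵥ x)) := by
  have hMP : M * P = 0 := by
    have := congrArg Matrix.transpose hPM
    rwa [Matrix.transpose_mul, hM.eq, hP.eq, Matrix.transpose_zero] at this
  have hsw : ∀ u v : n → ℝ, (P *ᵥ u) ⬝ᵥ v = u ⬝ᵥ (P *ᵥ v) := fun u v => by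
    rw [Matrix.dotProduct_mulVec, ← Matrix.mulVec_transpose, hP.eq]
  set y := x - P *ᵥ x with hy
  have hMy : M *ᵥ y = M *ᵥ x := by
    rw [hy, Matrix.mulVec_sub, Matrix.mulVec_mulVec, hMP, Matrix.zero_mulVec, sub_zero]
  have h1 : y ⬝ᵥ (M *ᵥ y) = x ⬝ᵥ (M *ᵥ x) := by
    rw [hMy, hy, sub_dotProduct, hsw, Matrix.mulVec_mulVec, hPM, Matrix.zero_mulVec,
      dotProduct_zero, sub_zero]
  have h2 : ∑ i, y i ^ 2 = x ⬝ᵥ x - x ⬝ᵥ (P *ᵥ x) := by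
    have : ∑ i, y i ^ 2 = y ⬝ᵥ y := by simp only [dotProduct, sq]
    rw [this, hy, sub_dotProduct, hsw, Matrix.mulVec_sub, Matrix.mulVec_mulVec, hPP, sub_self,
      dotProduct_zero, sub_zero, dotProduct_sub]
  have h3 := neg_specNorm_mul_le_dotProduct M y
  have h0 : 0 ≤ ∑ j, y j ^ 2 := Finset.sum_nonneg fun _ _ => sq_nonneg _
  change ∑ i, y i ^ 2 ≤ _
  rw [← h1, ← h2]
  nlinarith

end SpecNorm

section CliqueMatrix

variable {N k : ℕ} {C : Fin k → Finset (Fin N)}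

lemma eq_of_mem_of_mem (hdisj : ∀ q s, q ≠ s → Disjoint (C q) (C s)) {i : Fin N} {q s : Fin k}
    (hq : i ∈ C q) (hs : i ∈ C s) : q = s := by
  by_contra h
  exact Finset.disjoint_left.1 (hdisj q s h) hq hs

lemma cliqueMatrix_apply_of_mem (hdisj : ∀ q s, q ≠ s → Disjoint (C q) (C s)) {i : Fin N}
    {q : Fin k} (hi : i ∈ C q) (j : Fin N) :
    cliqueMatrix C i j = if j ∈ C q then 1 / ((C q).card : ℝ) else 0 := by
  rw [cliqueMatrix, Finset.sum_eq_single q]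
  · simp [hi]
  · intro s _ hs
    exact if_neg fun h => hs (eq_of_mem_of_mem hdisj h.1 hi)
  · simp

lemma cliqueMatrix_eq_zero {i j : Fin N} (h : ¬ ∃ q, i ∈ C q ∧ j ∈ C q) :
    cliqueMatrix C i j = 0 :=
  Finset.sum_eq_zero fun q _ => if_neg fun hq => h ⟨q, hq⟩

lemma cliqueMatrix_isSymm : (cliqueMatrix C).IsSymm := by
  ext i j
  simp only [Matrix.transpose_apply, cliqueMatrix, and_comm]

lemma cliqueMatrix_mul_apply (hdisj : ∀ q s, q ≠ s → Disjoint (C q) (C s)) {i : Fin N}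
    {q : Fin k} (hi : i ∈ C q) (M : Matrix (Fin N) (Fin N) ℝ) (j : Fin N) :
    (cliqueMatrix C * M) i j = 1 / ((C q).card : ℝ) * ∑ l ∈ C q, M l j := by
  rw [Matrix.mul_apply, Finset.mul_sum, ← Finset.sum_subset (Finset.subset_univ (C q))]
  · refine Finset.sum_congr rfl fun l hl => ?_
    rw [cliqueMatrix_apply_of_mem hdisj hi, if_pos hl]
  · intro l _ hl
    rw [cliqueMatrix_apply_of_mem hdisj hi, if_neg hl, zero_mul]

lemma cliqueMatrix_mul_apply_of_notMem {i : Fin N} (hi : ∀ q, i ∉ C q)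
    (M : Matrix (Fin N) (Fin N) ℝ) (j : Fin N) : (cliqueMatrix C * M) i j = 0 := by
  rw [Matrix.mul_apply]
  refine Finset.sum_eq_zero fun l _ => ?_
  rw [cliqueMatrix_eq_zero (by rintro ⟨q, hq, -⟩; exact hi q hq), zero_mul]

lemma cliqueMatrix_mul_self (hdisj : ∀ q s, q ≠ s → Disjoint (C q) (C s)) :
    cliqueMatrix C * cliqueMatrix C = cliqueMatrix C := by
  ext i j
  by_cases h : ∃ q, i ∈ C q
  · obtain ⟨q, hi⟩ := h
    have hc : ((C q).card : ℝ) ≠ 0 := by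
      exact_mod_cast (Finset.card_pos.2 ⟨i, hi⟩).ne'
    rw [cliqueMatrix_mul_apply hdisj hi, Finset.sum_congr rfl fun l hl =>
      (cliqueMatrix_apply_of_mem hdisj hl j).trans (cliqueMatrix_apply_of_mem hdisj hi j).symm]
    simp [hc]
  · push Not at h
    rw [cliqueMatrix_mul_apply_of_notMem h,
      cliqueMatrix_eq_zero (by rintro ⟨q, hq, -⟩; exact h q hq)]

lemma sum_cliqueMatrix_row (i : Fin N) :
    ∑ j, cliqueMatrix C i j = ∑ q, if i ∈ C q then 1 else 0 := by
  simp only [cliqueMatrix]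
  rw [Finset.sum_comm]
  refine Finset.sum_congr rfl fun q _ => ?_
  by_cases hi : i ∈ C q
  · have hc : ((C q).card : ℝ) ≠ 0 := by
      exact_mod_cast (Finset.card_pos.2 ⟨i, hi⟩).ne'
    simp [hi, hc]
  · simp [hi]

lemma sum_cliqueMatrix_row_le_one (hdisj : ∀ q s, q ≠ s → Disjoint (C q) (C s)) (i : Fin N) :
    ∑ j, cliqueMatrix C i j ≤ 1 := by
  rw [sum_cliqueMatrix_row]
  by_cases h : ∃ q, i ∈ C q
  · obtain ⟨q, hi⟩ := h
    rw [Finset.sum_eq_single q]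
    · simp [hi]
    · intro s _ hs
      exact if_neg fun h => hs (eq_of_mem_of_mem hdisj h hi)
    · simp
  · push Not at h
    simp [h]

lemma sum_cliqueMatrix : ∑ i, ∑ j, cliqueMatrix C i j = ((∑ q, (C q).card : ℕ) : ℝ) := by
  simp only [sum_cliqueMatrix_row]
  rw [Finset.sum_comm]
  simp

lemma trace_cliqueMatrix : (cliqueMatrix C).trace = ∑ q, if (C q).Nonempty then 1 else 0 := by
  simp only [Matrix.trace, Matrix.diag, cliqueMatrix, and_self]
  rw [Finset.sum_comm]
  refine Finset.sum_congr rfl fun q _ => ?_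
  by_cases h : (C q).Nonempty
  · have hc : ((C q).card : ℝ) ≠ 0 := by exact_mod_cast (Finset.card_pos.2 h).ne'
    simp [h, hc]
  · rw [Finset.not_nonempty_iff_eq_empty] at h
    simp [h]

lemma trace_cliqueMatrix_le : (cliqueMatrix C).trace ≤ k := by
  rw [trace_cliqueMatrix]
  calc _ ≤ ∑ _q : Fin k, (1 : ℝ) := Finset.sum_le_sum fun q _ => by split_ifs <;> norm_num
    _ = k := by simp

lemma trace_cliqueMatrix_eq_iff : (cliqueMatrix C).trace = k ↔ ∀ q, (C q).Nonempty := by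
  have hk : (k : ℝ) = ∑ _q : Fin k, (1 : ℝ) := by simp
  rw [trace_cliqueMatrix, hk, Finset.sum_eq_sum_iff_of_le fun q _ => by split_ifs <;> norm_num]
  refine ⟨fun h q => ?_, fun h q _ => if_pos (h q)⟩
  by_contra hq
  simpa [hq] using h q (Finset.mem_univ q)

lemma cliqueMatrix_posSemidef : (cliqueMatrix C).PosSemidef := by
  have : cliqueMatrix C = ∑ q, (1 / ((C q).card : ℝ)) •
      Matrix.vecMulVec (fun i => if i ∈ C q then (1 : ℝ) else 0)
        (star fun i => if i ∈ C q then (1 : ℝ) else 0) := by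
    ext i j
    rw [Matrix.sum_apply]
    refine Finset.sum_congr rfl fun q _ => ?_
    by_cases hi : i ∈ C q <;> by_cases hj : j ∈ C q <;> simp [Matrix.vecMulVec_apply, hi, hj]
  rw [this]
  exact Matrix.posSemidef_sum _ fun q _ =>
    (Matrix.posSemidef_vecMulVec_self_star _).smul (by positivity)

lemma cliqueMatrix_eq_zero_of_not_adj {G : SimpleGraph (Fin N)} (hclique : ∀ q, G.IsClique (C q))
    {i j : Fin N} (hij : i ≠ j) (h : ¬ G.Adj i j) : cliqueMatrix C i j = 0 :=
  cliqueMatrix_eq_zero fun ⟨q, hi, hj⟩ => h (hclique q hi hj hij)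

end CliqueMatrix

section Admissible

variable {N k : ℕ} {G : SimpleGraph (Fin N)} {C : Fin k → Finset (Fin N)} {rhat : ℕ}
  {St : Matrix (Fin N) (Fin N) ℝ}

lemma Admissible.cliqueMatrix_mul (hadm : Admissible G C rhat St)
    (hdisj : ∀ q s, q ≠ s → Disjoint (C q) (C s))
    (hout : ∀ j : Fin N, (∀ s, j ∉ C s) → ∀ q, nnb G j (C q) < (C q).card) :
    cliqueMatrix C * St = 0 := by
  obtain ⟨-, hdiag, -, -, hcol, hmix, -⟩ := hadm
  ext i j
  by_cases h : ∃ q, i ∈ C q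
  swap
  · push Not at h
    exact cliqueMatrix_mul_apply_of_notMem h St j
  obtain ⟨q, hi⟩ := h
  rw [cliqueMatrix_mul_apply hdisj hi, Matrix.zero_apply]
  refine mul_eq_zero_of_right _ ?_
  by_cases hj : ∃ s, j ∈ C s
  · obtain ⟨s, hj⟩ := hj
    by_cases hqs : q = s
    · subst hqs
      exact Finset.sum_eq_zero fun l hl => hdiag q l hl j hj
    · exact hcol q s hqs j hj
  · push Not at hj
    have hlt : (nnb G j (C q) : ℝ) < (C q).card := by exact_mod_cast hout j hj q
    have hcard : (((C q).filter fun u => ¬ G.Adj j u).card : ℝ)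
        = (C q).card - nnb G j (C q) := by
      rw [← Finset.card_filter_add_card_filter_not (s := C q) (fun u => G.Adj j u), nnb]
      push_cast
      ring
    rw [← Finset.sum_filter_add_sum_filter_not (C q) (fun u => G.Adj j u),
      Finset.sum_congr rfl fun l hl => ((hmix q l (Finset.mem_filter.1 hl).1 j hj).1
        (Finset.mem_filter.1 hl).2.symm).1,
      Finset.sum_congr (s₁ := (C q).filter fun u => ¬ G.Adj j u) rfl fun l hl =>
        ((hmix q l (Finset.mem_filter.1 hl).1 j hj).2
        fun h => (Finset.mem_filter.1 hl).2 h.symm).1,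
      Finset.sum_const, Finset.sum_const, nsmul_eq_mul, nsmul_eq_mul, hcard,
      mul_div_cancel₀ _ (sub_ne_zero.2 hlt.ne')]
    rw [nnb]
    ring

/-- The dual multiplier of the row-sum constraint. -/
noncomputable def rowMultiplier (C : Fin k → Finset (Fin N)) (rhat : ℕ) (i : Fin N) : ℝ :=
  ∑ q, if i ∈ C q then (1 - (rhat : ℝ) / (C q).card) / 2 else 0

lemma rowMultiplier_of_mem (hdisj : ∀ q s, q ≠ s → Disjoint (C q) (C s)) {i : Fin N} {q : Fin k}
    (hi : i ∈ C q) : rowMultiplier C rhat i = (1 - (rhat : ℝ) / (C q).card) / 2 := by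
  rw [rowMultiplier, Finset.sum_eq_single q]
  · exact if_pos hi
  · intro s _ hs
    exact if_neg fun h => hs (eq_of_mem_of_mem hdisj h hi)
  · simp

lemma rowMultiplier_of_notMem {i : Fin N} (hi : ∀ q, i ∉ C q) :
    rowMultiplier C rhat i = 0 :=
  Finset.sum_eq_zero fun q _ => if_neg (hi q)

lemma rowMultiplier_nonneg (hrhat_le : ∀ q, rhat ≤ (C q).card) (i : Fin N) :
    0 ≤ rowMultiplier C rhat i := by
  refine Finset.sum_nonneg fun q _ => ?_
  split_ifs
  · have : (rhat : ℝ) / (C q).card ≤ 1 :=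
      div_le_one_of_le₀ (by exact_mod_cast hrhat_le q) (by positivity)
    linarith
  · exact le_rfl

lemma two_mul_sum_rowMultiplier (hpos : ∀ q, 0 < (C q).card) :
    2 * ∑ i, rowMultiplier C rhat i = ((∑ q, (C q).card : ℕ) : ℝ) - rhat * k := by
  simp only [rowMultiplier]
  rw [Finset.sum_comm]
  have : ∀ q, ∑ i, (if i ∈ C q then (1 - (rhat : ℝ) / (C q).card) / 2 else 0)
      = ((C q).card - rhat) / 2 := fun q => by
    have hc : ((C q).card : ℝ) ≠ 0 := by exact_mod_cast (hpos q).ne'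
    simp only [Finset.sum_ite_mem, Finset.univ_inter, Finset.sum_const, nsmul_eq_mul]
    field_simp
  simp only [this]
  rw [← Finset.sum_div, mul_div_cancel₀ _ two_ne_zero, Finset.sum_sub_distrib]
  simp [mul_comm]

lemma Admissible.apply_sub_eq (hadm : Admissible G C rhat St)
    (hdisj : ∀ q s, q ≠ s → Disjoint (C q) (C s)) (hrhat : 0 < rhat)
    {i j : Fin N} (hij : G.Adj i j ∨ i = j) :
    St i j - rhat * cliqueMatrix C i j
      = -1 + rowMultiplier C rhat i + rowMultiplier C rhat j := by
  have hr : (rhat : ℝ) ≠ 0 := by exact_mod_cast hrhat.ne'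
  obtain ⟨-, hdiag, hoff, -, -, hmix, hrest⟩ := hadm
  by_cases hi : ∃ q, i ∈ C q <;> by_cases hj : ∃ s, j ∈ C s
  · obtain ⟨q, hi⟩ := hi
    obtain ⟨s, hj⟩ := hj
    rw [rowMultiplier_of_mem hdisj hi, rowMultiplier_of_mem hdisj hj,
      cliqueMatrix_apply_of_mem hdisj hi]
    by_cases hqs : q = s
    · subst hqs
      rw [if_pos hj, hdiag q i hi j hj]
      ring
    · rw [if_neg fun h => hqs (eq_of_mem_of_mem hdisj h hj), hoff q s hqs i hi j hj
        (hij.resolve_right fun h => hqs (eq_of_mem_of_mem hdisj hi (h ▸ hj))), cqs]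
      ring
  · obtain ⟨q, hi⟩ := hi
    push Not at hj
    rw [rowMultiplier_of_mem hdisj hi, rowMultiplier_of_notMem hj,
      cliqueMatrix_eq_zero (by rintro ⟨s, -, hs⟩; exact hj s hs),
      ((hmix q i hi j hj).1 (hij.resolve_right fun h => hj q (h ▸ hi))).1, cqK]
    field_simp
    ring
  · obtain ⟨s, hj⟩ := hj
    push Not at hi
    rw [rowMultiplier_of_mem hdisj hj, rowMultiplier_of_notMem hi,
      cliqueMatrix_eq_zero (by rintro ⟨q, hq, -⟩; exact hi q hq),
      ((hmix s j hj i hi).1 (hij.resolve_right fun h => hi s (h ▸ hj)).symm).2, cqK]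
    field_simp
    ring
  · push Not at hi hj
    rw [rowMultiplier_of_notMem hi, rowMultiplier_of_notMem hj,
      cliqueMatrix_eq_zero (by rintro ⟨q, hq, -⟩; exact hi q hq), hrest i j hi hj hij]
    ring

/-- Weak duality with an explicit gap, for a Gram matrix `Bᵀ * B` supported on the edges
of `G` and the diagonal, with row sums at most one. -/
lemma Admissible.sum_gram_add_le (hadm : Admissible G C rhat St)
    (hdisj : ∀ q s, q ≠ s → Disjoint (C q) (C s)) (hpos : ∀ q, 0 < (C q).card)
    (hrhat : 0 < rhat) (hrhat_le : ∀ q, rhat ≤ (C q).card)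
    (hout : ∀ j : Fin N, (∀ s, j ∉ C s) → ∀ q, nnb G j (C q) < (C q).card)
    (hnorm : specNorm St ≤ (rhat : ℝ) - 1) {X B : Matrix (Fin N) (Fin N) ℝ} (hXB : X = Bᵀ * B)
    (hrow : ∀ i, ∑ j, X i j ≤ 1) (hedge : ∀ i j, i ≠ j → ¬ G.Adj i j → X i j = 0) :
    ∑ i, ∑ j, X i j + ∑ l, ∑ i, (B l i - (cliqueMatrix C *ᵥ B l) i) ^ 2 + rhat * k
      ≤ ((∑ q, (C q).card : ℕ) : ℝ) + rhat * X.trace := by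
  have hX : ∀ i j, X i j = ∑ l, B l i * B l j := fun i j => by
    rw [hXB, Matrix.mul_apply]; rfl
  have hquad : ∀ M : Matrix (Fin N) (Fin N) ℝ,
      ∑ i, ∑ j, M i j * X i j = ∑ l, B l ⬝ᵥ (M *ᵥ B l) := fun M => by
    simp only [hX, Matrix.mulVec, dotProduct, Finset.mul_sum]
    rw [Finset.sum_comm (s := Finset.univ (α := Fin N))]
    refine Eq.trans ?_ Finset.sum_comm
    rw [Finset.sum_comm]
    refine Finset.sum_congr rfl fun i _ => ?_
    rw [Finset.sum_comm]
    refine Finset.sum_congr rfl fun l _ => Finset.sum_congr rfl fun j _ => ?_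
    ring
  have hdual : ∑ i, ∑ j, (St i j - rhat * cliqueMatrix C i j) * X i j
      = -∑ i, ∑ j, X i j + 2 * ∑ i, rowMultiplier C rhat i * ∑ j, X i j := by
    have hsymm : ∀ i j, X i j = X j i := fun i j => by
      rw [hX, hX]; exact Finset.sum_congr rfl fun l _ => mul_comm _ _
    have h1 : ∀ i j, (St i j - rhat * cliqueMatrix C i j) * X i j
        = -X i j + rowMultiplier C rhat i * X i j + rowMultiplier C rhat j * X j i := by
      intro i j
      rw [hsymm j i]
      by_cases hij : G.Adj i j ∨ i = j
      · rw [hadm.apply_sub_eq hdisj hrhat hij]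
        ring
      · push Not at hij
        rw [hedge i j hij.2 hij.1]
        ring
    have h2 : ∑ i, ∑ j, rowMultiplier C rhat j * X j i
        = ∑ i, ∑ j, rowMultiplier C rhat i * X i j := Finset.sum_comm
    simp only [h1, Finset.sum_add_distrib, h2, Finset.sum_neg_distrib, ← Finset.mul_sum]
    ring
  have hmul : ∑ i, rowMultiplier C rhat i * ∑ j, X i j ≤ ∑ i, rowMultiplier C rhat i :=
    Finset.sum_le_sum fun i _ =>
      mul_le_of_le_one_right (rowMultiplier_nonneg hrhat_le i) (hrow i)
  have htr : X.trace = ∑ l, B l ⬝ᵥ B l := by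
    simp only [Matrix.trace, Matrix.diag, hX, dotProduct]
    exact Finset.sum_comm
  have hgap := Finset.sum_le_sum fun l (_ : l ∈ Finset.univ) =>
    sum_sub_mulVec_sq_le St (cliqueMatrix C) rhat hadm.1 cliqueMatrix_isSymm
      (cliqueMatrix_mul_self hdisj) (hadm.cliqueMatrix_mul hdisj hout) hnorm (B l)
  rw [Finset.sum_add_distrib, ← Finset.mul_sum, Finset.sum_sub_distrib, ← htr, ← hquad,
    ← hquad] at hgap
  simp only [sub_mul, Finset.sum_sub_distrib, mul_assoc, ← Finset.mul_sum] at hdual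
  have hsum := two_mul_sum_rowMultiplier (rhat := rhat) hpos
  linarith

/-- A relaxed feasible point (trace at most `k`) is bounded by the size of the planted cliques. -/
lemma Admissible.sum_le (hadm : Admissible G C rhat St)
    (hdisj : ∀ q s, q ≠ s → Disjoint (C q) (C s)) (hpos : ∀ q, 0 < (C q).card)
    (hrhat : 0 < rhat) (hrhat_le : ∀ q, rhat ≤ (C q).card)
    (hout : ∀ j : Fin N, (∀ s, j ∉ C s) → ∀ q, nnb G j (C q) < (C q).card)
    (hnorm : specNorm St ≤ (rhat : ℝ) - 1) {X : Matrix (Fin N) (Fin N) ℝ}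
    (hrow : ∀ i, ∑ j, X i j ≤ 1) (hedge : ∀ i j, i ≠ j → ¬ G.Adj i j → X i j = 0)
    (htr : X.trace ≤ k) (hpsd : X.PosSemidef) :
    ∑ i, ∑ j, X i j ≤ ((∑ q, (C q).card : ℕ) : ℝ) := by
  obtain ⟨B, hB⟩ := exists_eq_transpose_mul_self hpsd
  have h := hadm.sum_gram_add_le hdisj hpos hrhat hrhat_le hout hnorm hB hrow hedge
  have hgap : 0 ≤ ∑ l, ∑ i, (B l i - (cliqueMatrix C *ᵥ B l) i) ^ 2 :=
    Finset.sum_nonneg fun l _ => Finset.sum_nonneg fun i _ => sq_nonneg _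
  have := mul_le_mul_of_nonneg_left htr (Nat.cast_nonneg (α := ℝ) rhat)
  linarith

lemma Admissible.eq_cliqueMatrix (hadm : Admissible G C rhat St)
    (hdisj : ∀ q s, q ≠ s → Disjoint (C q) (C s)) (hpos : ∀ q, 0 < (C q).card)
    (hrhat : 0 < rhat) (hrhat_le : ∀ q, rhat ≤ (C q).card)
    (hnb : ∀ (v : Fin N) (q : Fin k), v ∉ C q → nnb G v (C q) < (C q).card)
    (hnorm : specNorm St ≤ (rhat : ℝ) - 1) {X : Matrix (Fin N) (Fin N) ℝ}
    (hrow : ∀ i, ∑ j, X i j ≤ 1) (hedge : ∀ i j, i ≠ j → ¬ G.Adj i j → X i j = 0)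
    (htr : X.trace ≤ k) (hpsd : X.PosSemidef)
    (hopt : ∑ i, ∑ j, X i j = ((∑ q, (C q).card : ℕ) : ℝ)) :
    X = cliqueMatrix C := by
  obtain ⟨B, hB⟩ := exists_eq_transpose_mul_self hpsd
  have h := hadm.sum_gram_add_le hdisj hpos hrhat hrhat_le (fun j hj q => hnb j q (hj q)) hnorm
    hB hrow hedge
  have hgap : 0 ≤ ∑ l, ∑ i, (B l i - (cliqueMatrix C *ᵥ B l) i) ^ 2 :=
    Finset.sum_nonneg fun l _ => Finset.sum_nonneg fun i _ => sq_nonneg _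
  have hr : (0 : ℝ) < rhat := by exact_mod_cast hrhat
  have htrk : X.trace = k := le_antisymm htr (by nlinarith)
  have hgap0 : ∑ l, ∑ i, (B l i - (cliqueMatrix C *ᵥ B l) i) ^ 2 = 0 := by
    rw [htrk] at h
    linarith
  have hfix : ∀ l i, B l i = (cliqueMatrix C *ᵥ B l) i := by
    intro l i
    have h1 := (Finset.sum_eq_zero_iff_of_nonneg fun l _ =>
      Finset.sum_nonneg fun i _ => sq_nonneg _).1 hgap0 l (Finset.mem_univ l)
    have h2 := (Finset.sum_eq_zero_iff_of_nonneg fun i _ => sq_nonneg _).1 h1 i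
      (Finset.mem_univ i)
    exact sub_eq_zero.1 (pow_eq_zero_iff two_ne_zero |>.1 h2)
  have hX : ∀ i j, X i j = ∑ l, B l i * B l j := fun i j => by
    rw [hB, Matrix.mul_apply]; rfl
  have hsymm : ∀ i j, X i j = X j i := fun i j => by
    rw [hX, hX]; exact Finset.sum_congr rfl fun l _ => mul_comm _ _
  have hzero : ∀ i, (∀ q, i ∉ C q) → ∀ j, X i j = 0 := by
    intro i hi j
    rw [hX]
    refine Finset.sum_eq_zero fun l _ => ?_
    rw [hfix l i, Matrix.mulVec, dotProduct, Finset.sum_eq_zero, zero_mul]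
    intro u _
    rw [cliqueMatrix_eq_zero (by rintro ⟨q, hq, -⟩; exact hi q hq), zero_mul]
  have hconst : ∀ q, ∀ i ∈ C q, ∀ i' ∈ C q, ∀ j, X j i = X j i' := by
    intro q i hi i' hi' j
    rw [hX, hX]
    refine Finset.sum_congr rfl fun l _ => ?_
    rw [hfix l i, hfix l i', Matrix.mulVec, Matrix.mulVec]
    simp only [dotProduct, cliqueMatrix_apply_of_mem hdisj hi, cliqueMatrix_apply_of_mem hdisj hi']
  have hoff : ∀ q, ∀ i ∈ C q, ∀ j, j ∉ C q → X i j = 0 := by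
    intro q i hi j hj
    obtain ⟨u, hu, hju⟩ : ∃ u ∈ C q, ¬ G.Adj j u := by
      by_contra hcon
      push Not at hcon
      have := hnb j q hj
      rw [nnb, Finset.filter_true_of_mem hcon] at this
      exact lt_irrefl _ this
    rw [hsymm, hconst q i hi u hu j]
    exact hedge j u (fun h => hj (h ▸ hu)) hju
  have hdiag : ∀ i, X i i ≤ cliqueMatrix C i i := by
    intro i
    by_cases hi : ∃ q, i ∈ C q
    · obtain ⟨q, hi⟩ := hi
      have hc : (0 : ℝ) < (C q).card := by exact_mod_cast hpos q
      have h1 := hrow i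
      rw [← Finset.sum_subset (Finset.subset_univ (C q)) fun j _ hj => hoff q i hi j hj,
        Finset.sum_congr rfl fun j hj => hconst q j hj i hi i, Finset.sum_const,
        nsmul_eq_mul] at h1
      rw [cliqueMatrix_apply_of_mem hdisj hi, if_pos hi, le_div_iff₀ hc]
      linarith
    · push Not at hi
      rw [hzero i hi, cliqueMatrix_eq_zero (by rintro ⟨q, hq, -⟩; exact hi q hq)]
  have hdiag_eq : ∀ i, X i i = cliqueMatrix C i i := by
    have htrC : (cliqueMatrix C).trace = k :=
      trace_cliqueMatrix_eq_iff.2 fun q => Finset.card_pos.1 (hpos q)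
    intro i
    exact (Finset.sum_eq_sum_iff_of_le fun i _ => hdiag i).1 (htrk.trans htrC.symm) i
      (Finset.mem_univ i)
  ext i j
  by_cases hi : ∃ q, i ∈ C q
  · obtain ⟨q, hi⟩ := hi
    by_cases hj : j ∈ C q
    · rw [hconst q j hj i hi i, hdiag_eq, cliqueMatrix_apply_of_mem hdisj hi,
        cliqueMatrix_apply_of_mem hdisj hi, if_pos hi, if_pos hj]
    · rw [hoff q i hi j hj, cliqueMatrix_apply_of_mem hdisj hi, if_neg hj]
  · push Not at hi
    rw [hzero i hi, cliqueMatrix_eq_zero (by rintro ⟨q, hq, -⟩; exact hi q hq)]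

end Admissible

/-- Families of disjoint nonempty sets with the same clique matrix agree up to reordering. -/
lemma exists_perm_of_cliqueMatrix_eq {N k : ℕ} {C D : Fin k → Finset (Fin N)}
    (hC : ∀ q s, q ≠ s → Disjoint (C q) (C s)) (hD : ∀ q s, q ≠ s → Disjoint (D q) (D s))
    (hne : ∀ q, (D q).Nonempty) (h : cliqueMatrix D = cliqueMatrix C) :
    ∃ σ : Equiv.Perm (Fin k), ∀ q, D q = C (σ q) := by
  have hmem : ∀ {E : Fin k → Finset (Fin N)}, (∀ q s, q ≠ s → Disjoint (E q) (E s)) →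
      ∀ {q i}, i ∈ E q → ∀ j, j ∈ E q ↔ cliqueMatrix E i j ≠ 0 := by
    intro E hE q i hi j
    have hc : (E q).card ≠ 0 := (Finset.card_pos.2 ⟨i, hi⟩).ne'
    rw [cliqueMatrix_apply_of_mem hE hi]
    simp [hc]
  have hex : ∀ q, ∃ s, D q = C s := by
    intro q
    obtain ⟨i, hi⟩ := hne q
    have hii := (hmem hD hi i).1 hi
    obtain ⟨s, hs, -⟩ : ∃ s, i ∈ C s ∧ i ∈ C s := by
      by_contra hcon
      exact hii (h ▸ cliqueMatrix_eq_zero hcon)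
    refine ⟨s, Finset.ext fun j => ?_⟩
    rw [hmem hD hi, hmem hC hs, h]
  choose σ hσ using hex
  have hinj : Function.Injective σ := by
    intro q q' hqq
    obtain ⟨i, hi⟩ := hne q
    exact eq_of_mem_of_mem hD hi (by rwa [hσ q', ← hqq, ← hσ q])
  exact ⟨Equiv.ofBijective σ (Finite.injective_iff_bijective.1 hinj), hσ⟩

/-- Theorem 2.3: if some admissible matrix `S̃` satisfies `‖S̃‖ ≤ r̂ - 1`, then `X*` is
optimal for the SDP relaxation and the planted cliques maximize the number of covered
nodes among all collections of `k` pairwise disjoint cliques.  If moreover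
`‖S̃‖ < r̂ - 1` and `n_v^q < r_q` for every vertex `v` and clique `C_q` not containing
`v`, then `X*` is the unique optimal solution and the planted `k`-disjoint-clique
subgraph is the unique maximum one. -/
theorem optimality_and_uniqueness {N k : ℕ}
    (G : SimpleGraph (Fin N))
    (C : Fin k → Finset (Fin N))
    (hclique : ∀ q, G.IsClique (C q))
    (hdisj : ∀ q s, q ≠ s → Disjoint (C q) (C s))
    (hpos : ∀ q, 0 < (C q).card)
    (rhat : ℕ)
    (hrhat_le : ∀ q, rhat ≤ (C q).card)
    (hrhat_mem : ∃ q, rhat = (C q).card)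
    (hout : ∀ j : Fin N, (∀ s, j ∉ C s) → ∀ q, nnb G j (C q) < (C q).card)
    (Xstar : Matrix (Fin N) (Fin N) ℝ)
    (hXstar_in : ∀ q : Fin k, ∀ i ∈ C q, ∀ j ∈ C q,
      Xstar i j = 1 / ((C q).card : ℝ))
    (hXstar_out : ∀ i j : Fin N, (¬ ∃ q, i ∈ C q ∧ j ∈ C q) → Xstar i j = 0)
    (St : Matrix (Fin N) (Fin N) ℝ)
    (hadm : Admissible G C rhat St)
    (hnorm : specNorm St ≤ (rhat : ℝ) - 1) :
    (∀ X : Matrix (Fin N) (Fin N) ℝ, SDPFeasible G k X →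
      ∑ i, ∑ j, X i j ≤ ∑ i, ∑ j, Xstar i j) ∧
    (∀ D : Fin k → Finset (Fin N), (∀ q, G.IsClique (D q)) →
      (∀ q s, q ≠ s → Disjoint (D q) (D s)) →
      ∑ q, (D q).card ≤ ∑ q, (C q).card) ∧
    (specNorm St < (rhat : ℝ) - 1 →
      (∀ (v : Fin N) (q : Fin k), v ∉ C q → nnb G v (C q) < (C q).card) →
      (∀ X : Matrix (Fin N) (Fin N) ℝ, SDPFeasible G k X →
        (∑ i, ∑ j, X i j) = ∑ i, ∑ j, Xstar i j → X = Xstar) ∧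
      (∀ D : Fin k → Finset (Fin N), (∀ q, G.IsClique (D q)) →
        (∀ q s, q ≠ s → Disjoint (D q) (D s)) →
        (∑ q, (D q).card) = ∑ q, (C q).card →
        ∃ σ : Equiv.Perm (Fin k), ∀ q, D q = C (σ q))) := by
  have hrhat : 0 < rhat := by
    obtain ⟨q, hq⟩ := hrhat_mem
    exact hq ▸ hpos q
  have hX : Xstar = cliqueMatrix C := by
    ext i j
    by_cases h : ∃ q, i ∈ C q ∧ j ∈ C q
    · obtain ⟨q, hi, hj⟩ := h
      rw [hXstar_in q i hi j hj, cliqueMatrix_apply_of_mem hdisj hi, if_pos hj]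
    · rw [hXstar_out i j h, cliqueMatrix_eq_zero h]
  subst hX
  rw [sum_cliqueMatrix]
  refine ⟨fun X ⟨_, hrow, hedge, htr, hpsd⟩ =>
    hadm.sum_le hdisj hpos hrhat hrhat_le hout hnorm hrow hedge htr.le hpsd,
    fun D hDc hDd => ?_, fun _ hnb => ⟨fun X ⟨_, hrow, hedge, htr, hpsd⟩ hopt =>
    hadm.eq_cliqueMatrix hdisj hpos hrhat hrhat_le hnb hnorm hrow hedge htr.le hpsd hopt,
    fun D hDc hDd hsum => ?_⟩⟩
  · have h := hadm.sum_le hdisj hpos hrhat hrhat_le hout hnorm (sum_cliqueMatrix_row_le_one hDd)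
      (fun i j => cliqueMatrix_eq_zero_of_not_adj hDc) trace_cliqueMatrix_le
      cliqueMatrix_posSemidef
    rw [sum_cliqueMatrix] at h
    exact_mod_cast h
  · have h := hadm.eq_cliqueMatrix hdisj hpos hrhat hrhat_le hnb hnorm
      (sum_cliqueMatrix_row_le_one hDd) (fun i j => cliqueMatrix_eq_zero_of_not_adj hDc)
      trace_cliqueMatrix_le cliqueMatrix_posSemidef (by rw [sum_cliqueMatrix, hsum])
    refine exists_perm_of_cliqueMatrix_eq hdisj hDd ?_ h
    rw [← trace_cliqueMatrix_eq_iff, h, trace_cliqueMatrix_eq_iff]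
    exact fun q => Finset.card_pos.1 (hpos q)
end

section
/- (Null space and rank of the dual certificate, from the proof of Theorem 2.3.) Suppose some admissible matrix S̃ satisfies ‖S̃‖ < r̂ − 1 (spectral norm). Define the symmetric N×N matrix S by S[C_q,C_q] = r̂·I − (r̂/r_q)·ee^T for q = 1,…,k, S[C_{k+1},C_{k+1}] = S̃[C_{k+1},C_{k+1}] + r̂·I, and S[C_q,C_s] = S̃[C_q,C_s] for all q ≠ s. Then S is positive semidefinite, the null space of S is exactly the span of the indicator vectors v_1,…,v_k of the sets C_1,…,C_k (where [v_q]_j = 1 if j ∈ C_q and 0 otherwise), and rank(S) = N − k. -/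
open Finset Matrix
open scoped Classical

/-- The image of any vector is bounded by the spectral norm. -/
theorem sqrt_sum_sq_le_specNorm {m n : Type*} [Fintype m] [Fintype n]
    (M : Matrix m n ℝ) {x : n → ℝ} (hx : ∑ j, (x j) ^ 2 ≤ 1) :
    Real.sqrt (∑ i, (∑ j, M i j * x j) ^ 2) ≤ specNorm M := by
  refine le_csSup ⟨Real.sqrt (∑ i, ∑ j, (M i j) ^ 2), ?_⟩ ⟨x, hx, rfl⟩
  rintro _ ⟨y, hy, rfl⟩
  refine Real.sqrt_le_sqrt (sum_le_sum fun i _ => ?_)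
  calc (∑ j, M i j * y j) ^ 2 ≤ (∑ j, (M i j) ^ 2) * ∑ j, (y j) ^ 2 :=
        sum_mul_sq_le_sq_mul_sq _ _ _
    _ ≤ ∑ j, (M i j) ^ 2 :=
        mul_le_of_le_one_right (sum_nonneg fun _ _ => sq_nonneg _) hy

theorem neg_specNorm_mul_le_dotProduct_mulVec {n : Type*} [Fintype n]
    (M : Matrix n n ℝ) (x : n → ℝ) :
    -(specNorm M * (x ⬝ᵥ x)) ≤ x ⬝ᵥ (M *ᵥ x) := by
  have unit_case : ∀ y : n → ℝ, ∑ j, (y j) ^ 2 = 1 → -specNorm M ≤ y ⬝ᵥ (M *ᵥ y) := by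
    intro y hy
    have hM := sqrt_sum_sq_le_specNorm M hy.le
    have hcs : (y ⬝ᵥ (M *ᵥ y)) ^ 2 ≤ ∑ i, (∑ j, M i j * y j) ^ 2 := by
      have h := sum_mul_sq_le_sq_mul_sq univ y (M *ᵥ y)
      rw [hy, one_mul] at h
      exact h
    linarith [neg_abs_le (y ⬝ᵥ (M *ᵥ y)), Real.abs_le_sqrt hcs]
  rcases eq_or_ne x 0 with rfl | hx
  · simp
  have hpos : 0 < x ⬝ᵥ x := by
    simpa using dotProduct_star_self_pos_iff.mpr hx
  have hs : Real.sqrt (x ⬝ᵥ x) ^ 2 = x ⬝ᵥ x := Real.sq_sqrt hpos.le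
  have h := unit_case ((Real.sqrt (x ⬝ᵥ x))⁻¹ • x) (by
    simp only [Pi.smul_apply, smul_eq_mul, mul_pow, inv_pow, hs, ← mul_sum]
    rw [show ∑ i, x i ^ 2 = x ⬝ᵥ x by simp [dotProduct, sq]]
    exact inv_mul_cancel₀ hpos.ne')
  rw [mulVec_smul, dotProduct_smul, smul_dotProduct, smul_eq_mul, smul_eq_mul, ← mul_assoc,
    ← sq, inv_pow, hs, inv_mul_eq_div, le_div_iff₀ hpos] at h
  linarith

/-- Shifting a symmetric matrix which annihilates an orthogonal family by a multiple of the
projection onto the complement of that family, the multiple exceeding the spectral norm,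
yields a positive semidefinite matrix whose kernel is the span of the family. -/
theorem posSemidef_ker_rank_of_shifted {n ι : Type*} [Fintype n] [DecidableEq n]
    [Fintype ι] {T S : Matrix n n ℝ} {v : ι → n → ℝ} {d : ι → ℝ} {r : ℝ}
    (hd : ∀ q, 0 < d q) (hself : ∀ q, v q ⬝ᵥ v q = d q)
    (horth : ∀ q s, q ≠ s → v q ⬝ᵥ v s = 0)
    (hT : T.IsSymm) (hTv : ∀ q, T *ᵥ v q = 0) (hr : specNorm T < r)
    (hS : ∀ i j, S i j = T i j + (if i = j then r else 0)
      - ∑ q, r / d q * (v q i * v q j)) :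
    S.PosSemidef ∧
    (∀ x : n → ℝ, S *ᵥ x = 0 ↔ ∃ a : ι → ℝ, x = ∑ q, a q • v q) ∧
    S.rank = Fintype.card n - Fintype.card ι := by
  have hSymm : S.IsSymm := by
    ext i j
    simp only [transpose_apply, hS, hT.apply i j, mul_comm (v _ j), eq_comm (a := j)]
  have hSx : ∀ x, S *ᵥ x = T *ᵥ x + r • x - ∑ q, (r / d q * (v q ⬝ᵥ x)) • v q := by
    intro x
    ext i
    simp only [mulVec, dotProduct, hS, sub_mul, add_mul, sum_sub_distrib, sum_add_distrib,
      Pi.sub_apply, Pi.add_apply, Pi.smul_apply, smul_eq_mul, Finset.sum_apply, ite_mul,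
      zero_mul, sum_ite_eq, mem_univ, if_true, sum_mul, mul_sum]
    rw [sum_comm]
    congr 1
    exact sum_congr rfl fun q _ => sum_congr rfl fun j _ => by ring
  have hSv : ∀ q, S *ᵥ v q = 0 := by
    intro q
    rw [hSx, hTv, Finset.sum_eq_single q (fun s _ hs => by simp [horth s q hs]) (by simp),
      hself, div_mul_cancel₀ _ (hd q).ne']
    simp
  have hvS : ∀ q x, v q ⬝ᵥ (S *ᵥ x) = 0 := by
    intro q x
    rw [dotProduct_mulVec, ← mulVec_transpose, hSymm.eq, hSv, zero_dotProduct]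
  have key : ∀ x : n → ℝ, ∃ (a : ι → ℝ) (y : n → ℝ), x = ∑ q, a q • v q + y ∧
      (r - specNorm T) * (y ⬝ᵥ y) ≤ x ⬝ᵥ (S *ᵥ x) := by
    intro x
    set a : ι → ℝ := fun q => (v q ⬝ᵥ x) / d q
    set y : n → ℝ := x - ∑ q, a q • v q with hy
    have hxy : x = ∑ q, a q • v q + y := by rw [hy]; abel
    refine ⟨a, y, hxy, ?_⟩
    have hvy : ∀ q, v q ⬝ᵥ y = 0 := by
      intro q
      rw [hy, dotProduct_sub, dotProduct_sum, Finset.sum_eq_single q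
        (fun s _ hs => by simp [horth q s hs.symm]) (by simp), dotProduct_smul, hself,
        smul_eq_mul, div_mul_cancel₀ _ (hd q).ne', sub_self]
    have hSxy : S *ᵥ x = S *ᵥ y := by
      rw [hy, mulVec_sub, mulVec_sum]
      simp [mulVec_smul, hSv]
    have hSy : S *ᵥ y = T *ᵥ y + r • y := by simp [hSx, hvy]
    have hform : x ⬝ᵥ (S *ᵥ x) = y ⬝ᵥ (S *ᵥ y) := by
      rw [hSxy]
      nth_rewrite 1 [hxy]
      simp [add_dotProduct, sum_dotProduct, hvS]
    rw [hform, hSy, dotProduct_add, dotProduct_smul, smul_eq_mul]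
    linarith [neg_specNorm_mul_le_dotProduct_mulVec T y]
  have hsq : ∀ y : n → ℝ, 0 ≤ y ⬝ᵥ y := fun y => by simpa using dotProduct_star_self_nonneg y
  have hker : ∀ x : n → ℝ, S *ᵥ x = 0 ↔ ∃ a : ι → ℝ, x = ∑ q, a q • v q := by
    refine fun x => ⟨fun h => ?_, ?_⟩
    · obtain ⟨a, y, hxy, hle⟩ := key x
      rw [h, dotProduct_zero] at hle
      have hy : y ⬝ᵥ y = 0 := by nlinarith [hsq y]
      rw [dotProduct_self_eq_zero.mp hy, add_zero] at hxy
      exact ⟨a, hxy⟩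
    · rintro ⟨a, rfl⟩
      rw [mulVec_sum]
      simp [mulVec_smul, hSv]
  refine ⟨.of_dotProduct_mulVec_nonneg ?_ fun x => ?_, hker, ?_⟩
  · rw [IsHermitian, conjTranspose_eq_transpose_of_trivial, hSymm.eq]
  · obtain ⟨a, y, -, hle⟩ := key x
    simpa using (mul_nonneg (sub_nonneg.mpr hr.le) (hsq y)).trans hle
  · have hli : LinearIndependent ℝ v := by
      refine Fintype.linearIndependent_iff.mpr fun g hg q => ?_
      have h := congrArg (v q ⬝ᵥ ·) hg
      simp only [dotProduct_zero, dotProduct_sum, dotProduct_smul, smul_eq_mul] at h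
      rw [Finset.sum_eq_single q (fun s _ hs => by simp [horth q s hs.symm]) (by simp),
        hself] at h
      exact (mul_eq_zero.mp h).resolve_right (hd q).ne'
    have hspan : LinearMap.ker S.mulVecLin = Submodule.span ℝ (Set.range v) := by
      ext x
      rw [LinearMap.mem_ker, mulVecLin_apply, hker, Submodule.mem_span_range_iff_exists_fun]
      simp only [eq_comm]
    have h := LinearMap.finrank_range_add_finrank_ker S.mulVecLin
    rw [hspan, finrank_span_eq_card hli, Module.finrank_fintype_fun_eq_card] at h
    rw [Matrix.rank]
    omega

/-- An admissible matrix annihilates the indicator vectors of the cliques. -/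
theorem Admissible.sum_clique_eq_zero {N k : ℕ} {G : SimpleGraph (Fin N)}
    {C : Fin k → Finset (Fin N)} {rhat : ℕ} {St : Matrix (Fin N) (Fin N) ℝ}
    (hadm : Admissible G C rhat St)
    (hout : ∀ j : Fin N, (∀ s, j ∉ C s) → ∀ q, nnb G j (C q) < (C q).card)
    (i : Fin N) (q : Fin k) : ∑ j ∈ C q, St i j = 0 := by
  obtain ⟨-, hdiag, -, hrow, -, hcross, -⟩ := hadm
  by_cases hi : ∀ s, i ∉ C s
  · have hlt : (nnb G i (C q) : ℝ) < (C q).card := by exact_mod_cast hout i hi q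
    have hsplit : (C q).card = nnb G i (C q) + ((C q).filter fun u => ¬ G.Adj i u).card :=
      (card_filter_add_card_filter_not _).symm
    have hcard : (((C q).filter fun u => ¬ G.Adj i u).card : ℝ)
        = (C q).card - nnb G i (C q) := by
      rw [hsplit]; push_cast; ring
    rw [← sum_filter_add_sum_filter_not (C q) (fun u => G.Adj i u),
      sum_congr rfl (fun j hj => ((hcross q j (mem_filter.mp hj).1 i hi).1
        (mem_filter.mp hj).2.symm).2),
      sum_congr (s₁ := (C q).filter fun u => ¬ G.Adj i u) rfl (fun j hj => by
        obtain ⟨hj, hij⟩ := mem_filter.mp hj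
        obtain ⟨h1, h2⟩ := (hcross q j hj i hi).2 fun h => hij h.symm
        exact h2.trans h1),
      sum_const, sum_const, nsmul_eq_mul, nsmul_eq_mul, hcard,
      mul_div_cancel₀ _ (sub_pos.mpr hlt).ne']
    change (nnb G i (C q) : ℝ) * _ + _ = 0
    ring
  · push Not at hi
    obtain ⟨s, hs⟩ := hi
    rcases eq_or_ne s q with rfl | hsq
    · exact sum_eq_zero fun j hj => hdiag s i hs j hj
    · exact hrow s q hsq i hs

/-- From the proof of Theorem 2.3: if an admissible `S̃` satisfies `‖S̃‖ < r̂ - 1`, the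
dual certificate `S` (with clique diagonal blocks `r̂·I - (r̂/r_q)·ee^T`, outside diagonal
block `S̃[C_{k+1},C_{k+1}] + r̂·I`, and off-diagonal blocks equal to those of `S̃`) is
positive semidefinite, its null space is exactly the span of the indicator vectors of the
cliques `C_1, …, C_k`, and `rank S = N - k`. -/
theorem dual_certificate_nullspace_rank {N k : ℕ}
    (G : SimpleGraph (Fin N))
    (C : Fin k → Finset (Fin N))
    (hclique : ∀ q, G.IsClique (C q))
    (hdisj : ∀ q s, q ≠ s → Disjoint (C q) (C s))
    (hpos : ∀ q, 0 < (C q).card)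
    (rhat : ℕ)
    (hrhat_le : ∀ q, rhat ≤ (C q).card)
    (hrhat_mem : ∃ q, rhat = (C q).card)
    (hout : ∀ j : Fin N, (∀ s, j ∉ C s) → ∀ q, nnb G j (C q) < (C q).card)
    (St : Matrix (Fin N) (Fin N) ℝ)
    (hadm : Admissible G C rhat St)
    (hnorm : specNorm St < (rhat : ℝ) - 1)
    (S : Matrix (Fin N) (Fin N) ℝ)
    (hS_diag : ∀ q : Fin k, ∀ i ∈ C q, ∀ j ∈ C q,
      S i j = (if i = j then (rhat : ℝ) else 0) - (rhat : ℝ) / ((C q).card : ℝ))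
    (hS_out : ∀ i j : Fin N, (∀ s, i ∉ C s) → (∀ s, j ∉ C s) →
      S i j = St i j + (if i = j then (rhat : ℝ) else 0))
    (hS_off : ∀ i j : Fin N, (¬ ∃ q, i ∈ C q ∧ j ∈ C q) →
      ¬ ((∀ s, i ∉ C s) ∧ (∀ s, j ∉ C s)) → S i j = St i j) :
    S.PosSemidef ∧
    (∀ x : Fin N → ℝ, S.mulVec x = 0 ↔
      ∃ a : Fin k → ℝ, x = fun j => ∑ q, a q * (if j ∈ C q then 1 else 0)) ∧
    S.rank = N - k := by
  have mem_unique : ∀ {i q s}, i ∈ C q → i ∈ C s → q = s := fun {i q s} hq hs => by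
    by_contra hne
    exact disjoint_left.mp (hdisj q s hne) hq hs
  obtain ⟨hPSD, hker, hrank⟩ := posSemidef_ker_rank_of_shifted (T := St) (S := S)
    (v := fun q j => if j ∈ C q then 1 else 0) (d := fun q => ((C q).card : ℝ))
    (r := (rhat : ℝ)) (fun q => by exact_mod_cast hpos q) (fun q => by simp [dotProduct])
    (fun q s hqs => sum_eq_zero fun i _ => by
      by_cases hq : i ∈ C q
      · simp [show i ∉ C s from fun hs => hqs (mem_unique hq hs)]
      · simp [hq])
    hadm.1
    (fun q => funext fun i => by
      simpa [mulVec, dotProduct] using hadm.sum_clique_eq_zero hout i q)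
    (by linarith)
    (fun i j => by
      by_cases hij : ∃ q, i ∈ C q ∧ j ∈ C q
      · obtain ⟨q, hi, hj⟩ := hij
        rw [hS_diag q i hi j hj, hadm.2.1 q i hi j hj, zero_add, Finset.sum_eq_single q
          (fun s _ hs => by simp [show i ∉ C s from fun h => hs (mem_unique h hi)]) (by simp)]
        simp [hi, hj]
      · have hsum : ∑ q, (rhat : ℝ) / ((C q).card : ℝ) *
            ((if i ∈ C q then 1 else 0) * (if j ∈ C q then 1 else 0)) = 0 :=
          sum_eq_zero fun q _ => by
            by_cases hi : i ∈ C q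
            · simp [show j ∉ C q from fun hj => hij ⟨q, hi, hj⟩]
            · simp [hi]
        rw [hsum, sub_zero]
        by_cases ho : (∀ s, i ∉ C s) ∧ (∀ s, j ∉ C s)
        · exact hS_out i j ho.1 ho.2
        · have hne : i ≠ j := by
            rintro rfl
            exact ho ⟨fun s h => hij ⟨s, h, h⟩, fun s h => hij ⟨s, h, h⟩⟩
          rw [hS_off i j hij ho, if_neg hne, add_zero])
  refine ⟨hPSD, fun x => (hker x).trans (exists_congr fun a => ?_), by simpa using hrank⟩
  simp only [funext_iff, Finset.sum_apply, Pi.smul_apply, smul_eq_mul]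
end
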